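/- Let C = (C_1,…,C_d) be a row contraction on a Hilbert space H_C, A = (A_1,…,A_d) a row contraction on a Hilbert space H_A, and δ : 𝒟_{*,A} → 𝒟_C a contraction. Define B := D_{*,A} ∘ δ* ∘ D_C : H_C^d → H_A, and let E be the tuple on H_C ⊕ H_A with block matrices E_i = [[C_i, 0],[B_i, A_i]], where B_i := B ∘ ι_i with ι_i : H_C → H_C^d the i-th coordinate inclusion. Then for every h = h_C ⊕ h_A ∈ H_C ⊕ H_A one has the identity ‖D_{*,E} h‖² = ‖D_{*,C} h_C − 𝐂 δ D_{*,A} h_A‖² + ‖D_δ D_{*,A} h_A‖², where 𝐂 : H_C^d → H_C is the row operator of C and δ D_{*,A} : H_A → 𝒟_C ⊆ H_C^d. -/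

import Mathlib

noncomputable section

/-- The Hilbert space `ℓ²`-direct sum of `d` copies of `H`. -/
abbrev Hd (d : ℕ) (H : Type*) : Type _ := PiLp 2 fun _ : Fin d => H

/-- The row operator `𝐀 : H^d → K`, `(h_1, …, h_d) ↦ Σ_i A_i h_i`, of a `d`-tuple of
bounded operators `A_i : H → K`. -/
noncomputable def rowOp {d : ℕ} {H K : Type*} [NormedAddCommGroup H] [InnerProductSpace ℂ H]
    [NormedAddCommGroup K] [InnerProductSpace ℂ K] (A : Fin d → (H →L[ℂ] K)) :
    Hd d H →L[ℂ] K :=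
  ∑ i, (A i).comp ((ContinuousLinearMap.proj i).comp
    (PiLp.continuousLinearEquiv 2 ℂ fun _ : Fin d => H).toContinuousLinearMap)

/-- The `i`-th coordinate inclusion `ι_i : H → H^d`. -/
noncomputable def inclPi {d : ℕ} {H : Type*} [NormedAddCommGroup H] [InnerProductSpace ℂ H]
    (i : Fin d) : H →L[ℂ] Hd d H :=
  ((PiLp.continuousLinearEquiv 2 ℂ fun _ : Fin d => H).symm.toContinuousLinearMap).comp
    (ContinuousLinearMap.pi fun j => if j = i then ContinuousLinearMap.id ℂ H else 0)

/-- First coordinate projection of the Hilbert direct sum `H ⊕ K`. -/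
noncomputable def prodFst {H K : Type*} [NormedAddCommGroup H] [InnerProductSpace ℂ H]
    [NormedAddCommGroup K] [InnerProductSpace ℂ K] : WithLp 2 (H × K) →L[ℂ] H :=
  (ContinuousLinearMap.fst ℂ H K).comp (WithLp.prodContinuousLinearEquiv 2 ℂ H K).toContinuousLinearMap

/-- Second coordinate projection of the Hilbert direct sum `H ⊕ K`. -/
noncomputable def prodSnd {H K : Type*} [NormedAddCommGroup H] [InnerProductSpace ℂ H]
    [NormedAddCommGroup K] [InnerProductSpace ℂ K] : WithLp 2 (H × K) →L[ℂ] K :=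
  (ContinuousLinearMap.snd ℂ H K).comp (WithLp.prodContinuousLinearEquiv 2 ℂ H K).toContinuousLinearMap

/-- The `2 × 2` block operator `[[T₁₁, T₁₂], [T₂₁, T₂₂]] : H ⊕ K → H' ⊕ K'`. -/
noncomputable def block2 {H K H' K' : Type*}
    [NormedAddCommGroup H] [InnerProductSpace ℂ H] [NormedAddCommGroup K] [InnerProductSpace ℂ K]
    [NormedAddCommGroup H'] [InnerProductSpace ℂ H'] [NormedAddCommGroup K'] [InnerProductSpace ℂ K']
    (T11 : H →L[ℂ] H') (T12 : K →L[ℂ] H') (T21 : H →L[ℂ] K') (T22 : K →L[ℂ] K') :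
    WithLp 2 (H × K) →L[ℂ] WithLp 2 (H' × K') :=
  ((WithLp.prodContinuousLinearEquiv 2 ℂ H' K').symm.toContinuousLinearMap).comp
    ((T11.comp prodFst + T12.comp prodSnd).prod (T21.comp prodFst + T22.comp prodSnd))

/-- The defect space of a defect operator `D : H → K`: the closure of its range. -/
abbrev defectSpace {H K : Type*} [NormedAddCommGroup H] [InnerProductSpace ℂ H]
    [NormedAddCommGroup K] [InnerProductSpace ℂ K] (D : H →L[ℂ] K) : Submodule ℂ K :=
  (LinearMap.range (D : H →ₗ[ℂ] K)).topologicalClosure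

/-- A defect operator `D : H → K`, viewed as a map into its defect space. -/
noncomputable def toDefect {H K : Type*} [NormedAddCommGroup H] [InnerProductSpace ℂ H]
    [NormedAddCommGroup K] [InnerProductSpace ℂ K] (D : H →L[ℂ] K) : H →L[ℂ] ↥(defectSpace D) :=
  D.codRestrict _ fun x => Submodule.le_topologicalClosure _ (LinearMap.mem_range_self (D : H →ₗ[ℂ] K) x)

/-- The canonical identification `(H ⊕ K)^d ≅ H^d ⊕ K^d`:  from a pair
`(h, k) ∈ H^d ⊕ K^d` form the element of `(H ⊕ K)^d` with `i`-th entry `(h_i, k_i)`. -/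
noncomputable def pairup {d : ℕ} {H K : Type*} [NormedAddCommGroup H] [InnerProductSpace ℂ H]
    [NormedAddCommGroup K] [InnerProductSpace ℂ K] (h : Hd d H) (k : Hd d K) :
    Hd d (WithLp 2 (H × K)) :=
  (WithLp.equiv 2 _).symm fun i =>
    (WithLp.equiv 2 (H × K)).symm ((WithLp.equiv 2 _) h i, (WithLp.equiv 2 _) k i)


/-- A finite `ℓ²`-direct sum of complete spaces is complete. -/
instance PiLp.instCompleteSpaceOfFintype (p : ENNReal) [Fact (1 ≤ p)] {ι : Type*} [Fintype ι]
    (β : ι → Type*) [∀ i, NormedAddCommGroup (β i)] [∀ i, CompleteSpace (β i)] :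
    CompleteSpace (PiLp p β) := by
  have e : PiLp p β ≃ᵤ (∀ i, β i) :=
    { toEquiv := WithLp.equiv p _
      uniformContinuous_toFun := (PiLp.lipschitzWith_ofLp p β).uniformContinuous
      uniformContinuous_invFun := ((PiLp.antilipschitzWith_ofLp p β).to_rightInverse
        (fun _ => rfl)).uniformContinuous }
  exact e.completeSpace_iff.mpr inferInstance



section helpers
open ContinuousLinearMap

lemma aux_norm_sq {H : Type*} [NormedAddCommGroup H] [InnerProductSpace ℂ H] [CompleteSpace H]
    {K : Type*} [NormedAddCommGroup K] [InnerProductSpace ℂ K] [CompleteSpace K]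
    (D : H →L[ℂ] H) (hD : D.IsPositive) (T : H →L[ℂ] K)
    (h : D.comp D = 1 - (adjoint T).comp T) (x : H) :
    ‖D x‖ ^ 2 = ‖x‖ ^ 2 - ‖T x‖ ^ 2 := by
  have h1 : inner ℂ (D x) (D x) = inner ℂ x x - inner ℂ (T x) (T x) := by
    rw [hD.inner_left_eq_inner_right, ← adjoint_inner_right T, ← inner_sub_right]
    congr 1
    exact DFunLike.congr_fun h x
  have h2 := congrArg Complex.re h1
  rw [Complex.sub_re] at h2
  rw [← inner_self_eq_norm_sq (𝕜 := ℂ) (D x), ← inner_self_eq_norm_sq (𝕜 := ℂ) x,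
    ← inner_self_eq_norm_sq (𝕜 := ℂ) (T x)]
  exact h2

lemma aux_sylv {H : Type*} [NormedAddCommGroup H] [InnerProductSpace ℂ H] [CompleteSpace H]
    {K : Type*} [NormedAddCommGroup K] [InnerProductSpace ℂ K] [CompleteSpace K]
    (X : H →L[ℂ] K) (P : K →L[ℂ] K) (Q : H →L[ℂ] H) (hP : P.IsPositive) (hQ : Q.IsPositive)
    (h : P.comp X = - X.comp Q) : X.comp Q = 0 := by
  have e1 : ((adjoint X).comp X) * Q = - ((adjoint X).comp (P.comp X)) := by
    rw [h]; ext v; simp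
  have hp1 : ((adjoint X).comp (P.comp X)).IsPositive := hP.adjoint_conj X
  have hY : (0 : H →L[ℂ] H) ≤ (adjoint X).comp X :=
    (nonneg_iff_isPositive _).2 (isPositive_adjoint_comp_self X)
  have hQ0 : (0 : H →L[ℂ] H) ≤ Q := (nonneg_iff_isPositive _).2 hQ
  have hsa : IsSelfAdjoint (((adjoint X).comp X) * Q) := by
    rw [e1]; exact hp1.isSelfAdjoint.neg
  have hcomm : Commute ((adjoint X).comp X) Q :=
    (IsSelfAdjoint.commute_iff (isPositive_adjoint_comp_self X).isSelfAdjoint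
      hQ.isSelfAdjoint).2 hsa
  have h0 := Commute.mul_nonneg hY hQ0 hcomm
  have h1 : ((adjoint X).comp X) * Q = 0 := by
    refine le_antisymm ?_ h0
    rw [e1]
    exact neg_nonpos.2 ((nonneg_iff_isPositive _).2 hp1)
  ext v
  have h2 : adjoint X (X (Q v)) = 0 := DFunLike.congr_fun h1 v
  have h3 : inner ℂ (X (Q v)) (X (Q v)) = 0 := by
    rw [← adjoint_inner_right, h2, inner_zero_right]
  simpa using h3

lemma aux_intertwine {H : Type*} [NormedAddCommGroup H] [InnerProductSpace ℂ H] [CompleteSpace H]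
    {K : Type*} [NormedAddCommGroup K] [InnerProductSpace ℂ K] [CompleteSpace K]
    (T : H →L[ℂ] K) (P : K →L[ℂ] K) (Q : H →L[ℂ] H) (hP : P.IsPositive) (hQ : Q.IsPositive)
    (hQQ : Q.comp Q = 1 - (adjoint T).comp T) (hPP : P.comp P = 1 - T.comp (adjoint T)) (v : H) :
    T (Q v) = P (T v) := by
  have hq : ∀ v, Q (Q v) = v - adjoint T (T v) := fun v => DFunLike.congr_fun hQQ v
  have hp : ∀ v, P (P v) = v - T (adjoint T v) := fun v => DFunLike.congr_fun hPP v
  obtain ⟨X, hX⟩ : ∃ X : H →L[ℂ] K, X = T.comp Q - P.comp T := ⟨_, rfl⟩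
  have hXv : ∀ v, X v = T (Q v) - P (T v) := fun v => by rw [hX]; rfl
  have hs : P.comp X = - X.comp Q := by
    ext v
    simp [hXv, hq, hp]
  have h0 := aux_sylv X P Q hP hQ hs
  have hXQ : ∀ v, X (Q v) = 0 := fun v => DFunLike.congr_fun h0 v
  have hPX : ∀ v, P (X v) = 0 := fun v => by
    have := DFunLike.congr_fun hs v
    rw [h0] at this
    simpa using this
  have hXX : ∀ u, adjoint X (X u) = Q (adjoint T (X u)) := fun u => by
    refine ext_inner_left ℂ fun z => ?_
    rw [adjoint_inner_right, ← hQ.inner_left_eq_inner_right, adjoint_inner_right, hXv z,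
      inner_sub_left, hP.inner_left_eq_inner_right, hPX, inner_zero_right, sub_zero]
  have h1 : adjoint X (X v) = 0 := by
    rw [← inner_self_eq_zero (𝕜 := ℂ), adjoint_inner_right, hXX v, hXQ, inner_zero_left]
  have h2 : X v = 0 := by
    rw [← inner_self_eq_zero (𝕜 := ℂ), ← adjoint_inner_right, h1, inner_zero_right]
  rw [hXv] at h2
  exact sub_eq_zero.1 h2

lemma aux_rowOp_apply {d : ℕ} {H K : Type*} [NormedAddCommGroup H] [InnerProductSpace ℂ H]
    [NormedAddCommGroup K] [InnerProductSpace ℂ K] (A : Fin d → (H →L[ℂ] K)) (x : Hd d H) :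
    rowOp A x = ∑ i, A i (x i) := by
  simp [rowOp]

lemma aux_sum_incl {d : ℕ} {H : Type*} [NormedAddCommGroup H] [InnerProductSpace ℂ H]
    (x : Hd d H) : ∑ i, inclPi i (x i) = x := by
  ext j
  simp only [inclPi, WithLp.ofLp_sum, Finset.sum_apply]
  rw [Finset.sum_eq_single j]
  · simp
  · intro b _ hb
    simp [hb.symm]
  · simp

lemma aux_pairup_norm {d : ℕ} {H K : Type*} [NormedAddCommGroup H] [InnerProductSpace ℂ H]
    [NormedAddCommGroup K] [InnerProductSpace ℂ K] (h : Hd d H) (k : Hd d K) :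
    ‖pairup h k‖ ^ 2 = ‖h‖ ^ 2 + ‖k‖ ^ 2 := by
  rw [PiLp.norm_sq_eq_of_L2, PiLp.norm_sq_eq_of_L2, PiLp.norm_sq_eq_of_L2,
    ← Finset.sum_add_distrib]
  refine Finset.sum_congr rfl fun i _ => ?_
  rw [WithLp.prod_norm_sq_eq_of_L2]
  rfl

lemma aux_row_adj {d : ℕ} {H K : Type*} [NormedAddCommGroup H] [InnerProductSpace ℂ H]
    [CompleteSpace H] [NormedAddCommGroup K] [InnerProductSpace ℂ K] [CompleteSpace K]
    (C : Fin d → (H →L[ℂ] H)) (A : Fin d → (K →L[ℂ] K)) (B : Hd d H →L[ℂ] K)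
    (E : Fin d → (WithLp 2 (H × K) →L[ℂ] WithLp 2 (H × K)))
    (hE : ∀ i, E i = block2 (C i) 0 (B.comp (inclPi i)) (A i)) (hc : H) (ha : K) :
    adjoint (rowOp E) ((WithLp.equiv 2 (H × K)).symm (hc, ha)) =
      pairup (adjoint (rowOp C) hc + adjoint B ha) (adjoint (rowOp A) ha) := by
  refine ext_inner_left ℂ fun k => ?_
  obtain ⟨k1, hk1⟩ : ∃ k1 : Hd d H, ∀ i, k1 i = (k i).fst :=
    ⟨WithLp.toLp 2 fun i => (k i).fst, fun i => rfl⟩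
  obtain ⟨k2, hk2⟩ : ∃ k2 : Hd d K, ∀ i, k2 i = (k i).snd :=
    ⟨WithLp.toLp 2 fun i => (k i).snd, fun i => rfl⟩
  have e1 : rowOp E k = WithLp.toLp 2 (rowOp C k1, B k1 + rowOp A k2) := by
    have hBk : B k1 = ∑ i, B (inclPi i (k1 i)) := by
      rw [← map_sum, aux_sum_incl]
    have hi : ∀ i, E i (k i) =
        WithLp.toLp 2 (C i (k1 i), B (inclPi i (k1 i)) + A i (k2 i)) := fun i => by
      rw [hE, hk1, hk2]
      simp [block2, prodFst, prodSnd]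
    rw [aux_rowOp_apply, hBk, aux_rowOp_apply, aux_rowOp_apply, ← Finset.sum_add_distrib,
      Finset.sum_congr rfl fun i _ => hi i, ← WithLp.toLp_sum]
    congr 1
    ext <;> simp [Prod.fst_sum, Prod.snd_sum]
  have e2 : ∀ (u : Hd d H) (w : Hd d K), inner ℂ k (pairup u w) = inner ℂ k1 u + inner ℂ k2 w := by
    intro u w
    rw [PiLp.inner_apply, PiLp.inner_apply, PiLp.inner_apply, ← Finset.sum_add_distrib]
    refine Finset.sum_congr rfl fun i _ => ?_
    rw [WithLp.prod_inner_apply, hk1, hk2]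
    rfl
  rw [adjoint_inner_right, e1, e2, WithLp.prod_inner_apply, inner_add_right, adjoint_inner_right,
    adjoint_inner_right, adjoint_inner_right]
  change inner ℂ (rowOp C k1) hc + inner ℂ (B k1 + rowOp A k2) ha = _
  rw [inner_add_left, add_assoc]

end helpers

open ContinuousLinearMap in
/-- `‖D_{*,E} h‖² = ‖D_{*,C} h_C − 𝐂 δ D_{*,A} h_A‖² + ‖D_δ D_{*,A} h_A‖²`
for every `h = h_C ⊕ h_A ∈ H_C ⊕ H_A`. -/
theorem statement2 {d : ℕ} {H_C H_A : Type*}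
    [NormedAddCommGroup H_C] [InnerProductSpace ℂ H_C] [CompleteSpace H_C]
    [NormedAddCommGroup H_A] [InnerProductSpace ℂ H_A] [CompleteSpace H_A]
    (C : Fin d → (H_C →L[ℂ] H_C)) (A : Fin d → (H_A →L[ℂ] H_A))
    (hC : ‖rowOp C‖ ≤ 1) (hA : ‖rowOp A‖ ≤ 1)
    -- the defect operator `D_C` of `C`
    (DC : Hd d H_C →L[ℂ] Hd d H_C) (hDCpos : DC.IsPositive)
    (hDCsq : DC.comp DC = 1 - (adjoint (rowOp C)).comp (rowOp C))
    -- the defect operator `D_{*,C}` of `C`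
    (DsC : H_C →L[ℂ] H_C) (hDsCpos : DsC.IsPositive)
    (hDsCsq : DsC.comp DsC = 1 - (rowOp C).comp (adjoint (rowOp C)))
    -- the defect operator `D_{*,A}` of `A`
    (DsA : H_A →L[ℂ] H_A) (hDsApos : DsA.IsPositive)
    (hDsAsq : DsA.comp DsA = 1 - (rowOp A).comp (adjoint (rowOp A)))
    -- the contraction `δ : 𝒟_{*,A} → 𝒟_C`
    (δ : ↥(defectSpace DsA) →L[ℂ] ↥(defectSpace DC)) (hδ : ‖δ‖ ≤ 1)
    -- the defect operator `D_δ` of `δ`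
    (Dδ : ↥(defectSpace DsA) →L[ℂ] ↥(defectSpace DsA)) (hDδpos : Dδ.IsPositive)
    (hDδsq : Dδ.comp Dδ = 1 - (adjoint δ).comp δ)
    -- `B := D_{*,A} ∘ δ* ∘ D_C : H_C^d → H_A`
    (B : Hd d H_C →L[ℂ] H_A)
    (hB : B = DsA.comp (((defectSpace DsA).subtypeL).comp ((adjoint δ).comp (toDefect DC))))
    -- the lifting `E`, `E_i = [[C_i, 0], [B ∘ ι_i, A_i]]`
    (E : Fin d → (WithLp 2 (H_C × H_A) →L[ℂ] WithLp 2 (H_C × H_A)))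
    (hE : ∀ i, E i = block2 (C i) 0 (B.comp (inclPi i)) (A i))
    -- the defect operator `D_{*,E}` of `E`
    (DsE : WithLp 2 (H_C × H_A) →L[ℂ] WithLp 2 (H_C × H_A)) (hDsEpos : DsE.IsPositive)
    (hDsEsq : DsE.comp DsE = 1 - (rowOp E).comp (adjoint (rowOp E))) :
    ∀ (hc : H_C) (ha : H_A),
      ‖DsE ((WithLp.equiv 2 (H_C × H_A)).symm (hc, ha))‖ ^ 2 =
        ‖DsC hc - (rowOp C) ((δ (toDefect DsA ha) : ↥(defectSpace DC)) : Hd d H_C)‖ ^ 2 +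
          ‖Dδ (toDefect DsA ha)‖ ^ 2 := by
  intro hc ha
  set t := toDefect DsA ha with ht
  obtain ⟨x, hx⟩ : ∃ x : Hd d H_C, x = ((δ t : ↥(defectSpace DC)) : Hd d H_C) := ⟨_, rfl⟩
  have hBadj : adjoint B ha = DC x := by
    refine ext_inner_left ℂ fun z => ?_
    rw [adjoint_inner_right, hB, hx, ← hDCpos.inner_left_eq_inner_right]
    change inner ℂ (DsA ((adjoint δ (toDefect DC z) : ↥(defectSpace DsA)) : H_A)) ha = _
    rw [hDsApos.inner_left_eq_inner_right]
    change inner ℂ (adjoint δ (toDefect DC z)) t = inner ℂ (toDefect DC z) (δ t)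
    rw [adjoint_inner_left]
  have n1 := aux_norm_sq DsE hDsEpos (adjoint (rowOp E)) (by rw [adjoint_adjoint]; exact hDsEsq)
    ((WithLp.equiv 2 (H_C × H_A)).symm (hc, ha))
  rw [aux_row_adj C A B E hE, aux_pairup_norm, hBadj,
    WithLp.prod_norm_sq_eq_of_L2 ((WithLp.equiv 2 (H_C × H_A)).symm (hc, ha))] at n1
  change _ = ‖hc‖ ^ 2 + ‖ha‖ ^ 2 - _ at n1
  have n2 := aux_norm_sq DsC hDsCpos (adjoint (rowOp C)) (by rw [adjoint_adjoint]; exact hDsCsq) hc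
  have n3 := aux_norm_sq DsA hDsApos (adjoint (rowOp A)) (by rw [adjoint_adjoint]; exact hDsAsq) ha
  have n4 := aux_norm_sq DC hDCpos (rowOp C) hDCsq x
  have n5 := aux_norm_sq Dδ hDδpos δ hDδsq t
  have n6 : ‖t‖ = ‖DsA ha‖ := rfl
  have n7 : ‖δ t‖ = ‖x‖ := by rw [hx]; rfl
  have n8 : inner ℂ (adjoint (rowOp C) hc) (DC x) = inner ℂ (DsC hc) (rowOp C x) := by
    rw [adjoint_inner_left, hDsCpos.inner_left_eq_inner_right,
      aux_intertwine (rowOp C) DsC DC hDsCpos hDCpos hDCsq hDsCsq]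
  have n9 := norm_add_sq (𝕜 := ℂ) (adjoint (rowOp C) hc) (DC x)
  have n10 := norm_sub_sq (𝕜 := ℂ) (DsC hc) (rowOp C x)
  rw [n8] at n9
  rw [n6, n7] at n5
  rw [← hx]
  linarith
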